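/- arXiv:2306.09006 — 9 statements merged into one kernel-verified Lean document; each statement's English description precedes it below -/
import Mathlib

section
/- Let r be a nonempty finite relation of tuples over a scheme with predicates Φ, X → A a functional dependency, and r' the set of tuples t ∈ r such that (t,t) is not a counterexample to X → A. Then g₃^Φ(r, X → A) = 1 − α/|r|, where α is the maximum cardinality of an independent set of the conflict graph on r'. -/
/-- `(t₁, t₂)` is a counterexample to the FD `X → A`. -/
def Counterexample {ι : Type*} {D : ι → Type*} (φ : ∀ i, D i → D i → Prop)
    (X : Set ι) (A : ι) (t₁ t₂ : ∀ i, D i) : Prop :=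
  (∀ B ∈ X, φ B (t₁ B) (t₂ B)) ∧ ¬ φ A (t₁ A) (t₂ A)

/-- A set `s` of tuples satisfies `X → A` w.r.t. the predicates `φ`. -/
def Satisfies {ι : Type*} {D : ι → Type*} (φ : ∀ i, D i → D i → Prop)
    (X : Set ι) (A : ι) (s : Set (∀ i, D i)) : Prop :=
  ∀ t₁ ∈ s, ∀ t₂ ∈ s, ¬ Counterexample φ X A t₁ t₂

/-- The conflict graph of `X → A` on a set `r` of tuples. -/
def conflictGraph {ι : Type*} {D : ι → Type*} (φ : ∀ i, D i → D i → Prop)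
    (X : Set ι) (A : ι) (r : Set (∀ i, D i)) : SimpleGraph r :=
  SimpleGraph.fromRel (fun t₁ t₂ => Counterexample φ X A (t₁ : ∀ i, D i) (t₂ : ∀ i, D i))

/-- The `g₃`-error with predicates of `X → A` w.r.t. `r`:
`1 - (max{|s| : s ⊆ r, s satisfies X → A}) / |r|`. -/
noncomputable def g3 {ι : Type*} {D : ι → Type*} (φ : ∀ i, D i → D i → Prop)
    (X : Set ι) (A : ι) (r : Set (∀ i, D i)) : ℝ :=
  1 - ((sSup {n : ℕ | ∃ s ⊆ r, Satisfies φ X A s ∧ s.ncard = n} : ℕ) : ℝ) / r.ncard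

/-- A set of reflexively consistent tuples of `r` is independent in the conflict graph
exactly when it satisfies the dependency. -/
theorem satisfies_image_val_iff {ι : Type*} {D : ι → Type*} (φ : ∀ i, D i → D i → Prop)
    (X : Set ι) (A : ι) (r : Set (∀ i, D i))
    (I : Set {t ∈ r | ¬ Counterexample φ X A t t}) :
    Satisfies φ X A (Subtype.val '' I) ↔ I.Pairwise fun t₁ t₂ =>
      ¬ (conflictGraph φ X A {t ∈ r | ¬ Counterexample φ X A t t}).Adj t₁ t₂ := by
  constructor
  · rintro h a ha b hb - hadj
    rcases ((SimpleGraph.fromRel_adj _ _ _).1 hadj).2 with hc | hc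
    · exact h _ ⟨a, ha, rfl⟩ _ ⟨b, hb, rfl⟩ hc
    · exact h _ ⟨b, hb, rfl⟩ _ ⟨a, ha, rfl⟩ hc
  · rintro h _ ⟨a, ha, rfl⟩ _ ⟨b, hb, rfl⟩ hc
    by_cases hab : a = b
    · subst hab
      exact a.2.2 hc
    · exact h ha hb hab ((SimpleGraph.fromRel_adj _ _ _).2 ⟨hab, Or.inl hc⟩)

theorem stmt_1 {ι : Type*} {D : ι → Type*} (φ : ∀ i, D i → D i → Prop)
    (X : Set ι) (A : ι) (r : Set (∀ i, D i)) (hr : r.Finite) (hne : r.Nonempty)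
    (α : ℕ)
    (hα : α = sSup {n : ℕ | ∃ I : Set {t ∈ r | ¬ Counterexample φ X A t t},
        (I.Pairwise fun t₁ t₂ =>
          ¬ (conflictGraph φ X A {t ∈ r | ¬ Counterexample φ X A t t}).Adj t₁ t₂) ∧
        I.ncard = n}) :
    g3 φ X A r = 1 - (α : ℝ) / r.ncard := by
  subst hα
  unfold g3
  congr 4
  ext n
  constructor
  · rintro ⟨s, hsr, hs, rfl⟩
    have hsub : s ⊆ {t ∈ r | ¬ Counterexample φ X A t t} :=
      fun t ht => ⟨hsr ht, hs t ht t ht⟩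
    have himage : Subtype.val ''
        (Subtype.val ⁻¹' s : Set {t ∈ r | ¬ Counterexample φ X A t t}) = s := by
      rw [Subtype.image_preimage_coe, Set.inter_eq_right.2 hsub]
    refine ⟨Subtype.val ⁻¹' s, (satisfies_image_val_iff φ X A r _).1 (himage.symm ▸ hs), ?_⟩
    rw [← Set.ncard_image_of_injective _ Subtype.val_injective, himage]
  · rintro ⟨I, hI, rfl⟩
    refine ⟨Subtype.val '' I, ?_, (satisfies_image_val_iff φ X A r I).2 hI,
      Set.ncard_image_of_injective _ Subtype.val_injective⟩
    rintro _ ⟨a, -, rfl⟩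
    exact a.2.1
end

section
/- Let r be a finite relation of tuples, X a set of attributes and A an attribute, where every attribute is compared with equality. Then the conflict graph of X → A on r (distinct tuples t₁,t₂ adjacent iff t₁[X] = t₂[X] and t₁[A] ≠ t₂[A]) contains no induced path on four vertices; that is, it is a co-graph: there are no four distinct tuples t₁,t₂,t₃,t₄ in r with t₁t₂, t₂t₃, t₃t₄ adjacent and t₁t₃, t₁t₄, t₂t₄ non-adjacent. -/
/-- Two distinct tuples are adjacent in the conflict graph of `X → A` (with equality
as the predicate on every attribute) iff they agree on every attribute of `X` and
differ on `A`. -/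
def eqConflictAdj {ι : Type*} {D : ι → Type*} (X : Set ι) (A : ι)
    (t₁ t₂ : ∀ i, D i) : Prop :=
  t₁ ≠ t₂ ∧ (∀ B ∈ X, t₁ B = t₂ B) ∧ t₁ A ≠ t₂ A

theorem stmt_2 {ι : Type*} {D : ι → Type*} [∀ i, DecidableEq (D i)]
    (X : Set ι) (A : ι) (r : Set (∀ i, D i)) (hr : r.Finite) :
    ¬ ∃ t₁ t₂ t₃ t₄ : ∀ i, D i,
      t₁ ∈ r ∧ t₂ ∈ r ∧ t₃ ∈ r ∧ t₄ ∈ r ∧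
      t₁ ≠ t₂ ∧ t₁ ≠ t₃ ∧ t₁ ≠ t₄ ∧ t₂ ≠ t₃ ∧ t₂ ≠ t₄ ∧ t₃ ≠ t₄ ∧
      eqConflictAdj X A t₁ t₂ ∧ eqConflictAdj X A t₂ t₃ ∧ eqConflictAdj X A t₃ t₄ ∧
      ¬ eqConflictAdj X A t₁ t₃ ∧ ¬ eqConflictAdj X A t₁ t₄ ∧ ¬ eqConflictAdj X A t₂ t₄ := by
  rintro ⟨t₁, t₂, t₃, t₄, -, -, -, -, -, h₁₃, h₁₄, -, -, -,
    ⟨-, x₁₂, -⟩, ⟨-, x₂₃, -⟩, ⟨-, x₃₄, a₃₄⟩, n₁₃, n₁₄, -⟩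
  have x₁₃ : ∀ B ∈ X, t₁ B = t₃ B := fun B hB => (x₁₂ B hB).trans (x₂₃ B hB)
  have a₁₃ : t₁ A = t₃ A := by
    by_contra h
    exact n₁₃ ⟨h₁₃, x₁₃, h⟩
  have a₁₄ : t₁ A = t₄ A := by
    by_contra h
    exact n₁₄ ⟨h₁₄, fun B hB => (x₁₃ B hB).trans (x₃₄ B hB), h⟩
  exact a₃₄ (a₁₃.symm.trans a₁₄)
end

section
/- Suppose that for every attribute i the predicate φ_i is symmetric (φ_i x y ↔ φ_i y x) and transitive (φ_i x y and φ_i y z imply φ_i x z). Let r be a finite relation of tuples and let r' be the set of tuples t ∈ r such that (t,t) is not a counterexample to X → A. Then the conflict graph of X → A on r' contains no induced path on four vertices; that is, it is a co-graph: there are no four distinct tuples t₁,t₂,t₃,t₄ in r' with t₁t₂, t₂t₃, t₃t₄ adjacent and t₁t₃, t₁t₄, t₂t₄ non-adjacent. -/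
/-- Adjacency in the conflict graph of `X → A`: distinct tuples `t₁, t₂` are adjacent
iff `(t₁, t₂)` or `(t₂, t₁)` is a counterexample to `X → A`. -/
def conflictAdj {ι : Type*} {D : ι → Type*} (φ : ∀ i, D i → D i → Prop)
    (X : Set ι) (A : ι) (t₁ t₂ : ∀ i, D i) : Prop :=
  t₁ ≠ t₂ ∧ (Counterexample φ X A t₁ t₂ ∨ Counterexample φ X A t₂ t₁)

/-- If every `φ i` is symmetric, then so is the counterexample relation. -/
theorem Counterexample.symm_of {ι : Type*} {D : ι → Type*} {φ : ∀ i, D i → D i → Prop}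
    (hsym : ∀ i, ∀ x y : D i, φ i x y ↔ φ i y x) {X : Set ι} {A : ι} {s t : ∀ i, D i}
    (h : Counterexample φ X A s t) : Counterexample φ X A t s :=
  ⟨fun B hB => (hsym B _ _).1 (h.1 B hB), fun hA => h.2 ((hsym A _ _).1 hA)⟩

/-- For symmetric predicates, adjacent tuples form a counterexample in either order. -/
theorem conflictAdj.counterexample {ι : Type*} {D : ι → Type*} {φ : ∀ i, D i → D i → Prop}
    (hsym : ∀ i, ∀ x y : D i, φ i x y ↔ φ i y x) {X : Set ι} {A : ι} {s t : ∀ i, D i}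
    (h : conflictAdj φ X A s t) : Counterexample φ X A s t :=
  h.2.elim id (Counterexample.symm_of hsym)

theorem stmt_3 {ι : Type*} {D : ι → Type*} (φ : ∀ i, D i → D i → Prop)
    (hsym : ∀ i, ∀ x y : D i, φ i x y ↔ φ i y x)
    (htrans : ∀ i, ∀ x y z : D i, φ i x y → φ i y z → φ i x z)
    (X : Set ι) (A : ι) (r : Set (∀ i, D i)) (hr : r.Finite) :
    ¬ ∃ t₁ t₂ t₃ t₄ : ∀ i, D i,
      t₁ ∈ {t ∈ r | ¬ Counterexample φ X A t t} ∧
      t₂ ∈ {t ∈ r | ¬ Counterexample φ X A t t} ∧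
      t₃ ∈ {t ∈ r | ¬ Counterexample φ X A t t} ∧
      t₄ ∈ {t ∈ r | ¬ Counterexample φ X A t t} ∧
      t₁ ≠ t₂ ∧ t₁ ≠ t₃ ∧ t₁ ≠ t₄ ∧ t₂ ≠ t₃ ∧ t₂ ≠ t₄ ∧ t₃ ≠ t₄ ∧
      conflictAdj φ X A t₁ t₂ ∧ conflictAdj φ X A t₂ t₃ ∧ conflictAdj φ X A t₃ t₄ ∧
      ¬ conflictAdj φ X A t₁ t₃ ∧ ¬ conflictAdj φ X A t₁ t₄ ∧ ¬ conflictAdj φ X A t₂ t₄ := by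
  rintro ⟨t₁, t₂, t₃, t₄, -, -, -, -, -, h₁₃, h₁₄, -, -, -, a₁₂, a₂₃, a₃₄, n₁₃, n₁₄, -⟩
  have c₃₄ := a₃₄.counterexample hsym
  have e₁₃ : ∀ B ∈ X, φ B (t₁ B) (t₃ B) := fun B hB =>
    htrans B _ _ _ ((a₁₂.counterexample hsym).1 B hB) ((a₂₃.counterexample hsym).1 B hB)
  have e₁₄ : ∀ B ∈ X, φ B (t₁ B) (t₄ B) := fun B hB =>
    htrans B _ _ _ (e₁₃ B hB) (c₃₄.1 B hB)
  have p₁₃ : φ A (t₁ A) (t₃ A) := by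
    by_contra h
    exact n₁₃ ⟨h₁₃, Or.inl ⟨e₁₃, h⟩⟩
  have p₁₄ : φ A (t₁ A) (t₄ A) := by
    by_contra h
    exact n₁₄ ⟨h₁₄, Or.inl ⟨e₁₄, h⟩⟩
  exact c₃₄.2 (htrans A _ _ _ ((hsym A _ _).1 p₁₃) p₁₄)
end

section
/- Let G be a simple graph on Fin n and define φ : Fin 3 → Fin 3 → Prop by φ x y ↔ (x = y ∨ x.val + y.val < 3). For each vertex i define the tuple t_i assigning to each edge e of G the value: 0 if i is not an endpoint of e, 1 if i is the smaller endpoint of e, and 2 if i is the larger endpoint of e. Then for all distinct vertices i, j: φ (t_i e) (t_j e) holds for every edge e of G if and only if i and j are NOT adjacent in G. -/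
/-- The predicate `φ` on `Fin 3`: `φ x y` holds iff `x = y` or `x + y < 3`. -/
def phi3 (x y : Fin 3) : Prop := x = y ∨ x.val + y.val < 3

/-- The tuple associated to a vertex `i`: it assigns to each edge `e` of `G` the value
`0` if `i` is not an endpoint of `e`, `1` if `i` is the smaller endpoint of `e`, and
`2` if `i` is the larger endpoint of `e`. -/
def vertexTuple {n : ℕ} (G : SimpleGraph (Fin n)) (i : Fin n) (e : G.edgeSet) : Fin 3 :=
  if i ∈ (e : Sym2 (Fin n)) then
    (if i = Sym2.inf (e : Sym2 (Fin n)) then 1 else 2)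
  else 0

theorem stmt_7 {n : ℕ} (G : SimpleGraph (Fin n)) (i j : Fin n) (hij : i ≠ j) :
    (∀ e : G.edgeSet, phi3 (vertexTuple G i e) (vertexTuple G j e)) ↔ ¬ G.Adj i j := by
  constructor
  · intro h hadj
    have he := h ⟨s(i, j), hadj⟩
    rcases lt_or_gt_of_ne hij with hlt | hlt
    · simp [phi3, vertexTuple, inf_eq_left.mpr hlt.le, hij.symm] at he
    · simp [phi3, vertexTuple, inf_eq_right.mpr hlt.le, hij] at he
  · rintro hadj ⟨e, he⟩
    by_cases hi : i ∈ e
    · by_cases hj : j ∈ e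
      · obtain rfl := (Sym2.mem_and_mem_iff hij).mp ⟨hi, hj⟩
        exact absurd he hadj
      · right
        simp only [vertexTuple, if_neg hj]
        exact Fin.is_lt _
    · right
      simp only [vertexTuple, if_neg hi, Fin.val_zero, zero_add]
      exact Fin.is_lt _
end

section
/- Let G be a simple graph on Fin n. With the predicate φ x y ↔ (x = y ∨ x.val + y.val < 3) on Fin 3 for each edge-attribute, equality as the predicate on an extra attribute A, and the tuples T_i = (t_i, i) where t_i assigns to each edge e the value 0 if i ∉ e, 1 if i is the smaller endpoint of e and 2 if i is the larger endpoint of e: a subset K ⊆ Fin n is a clique of G if and only if the set of tuples {T_i : i ∈ K} satisfies the functional dependency X → A, where X is the set of edge-attributes. Consequently, the maximum size of a clique of G equals the maximum cardinality of a subset of {T_1,…,T_n} satisfying X → A. -/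
/-- The full tuple `T_i = (t_i, i)` over the scheme consisting of the edge-attributes
`X` (valued in `Fin 3`) and the extra attribute `A` (valued in `Fin n`). -/
def T {n : ℕ} (G : SimpleGraph (Fin n)) (i : Fin n) : (G.edgeSet → Fin 3) × Fin n :=
  (vertexTuple G i, i)

/-- `(s, t)` is a counterexample to `X → A`: `φ (s e) (t e)` holds for every
edge-attribute `e ∈ X`, but the `A`-values differ. -/
def CounterexampleT {n : ℕ} (G : SimpleGraph (Fin n))
    (s t : (G.edgeSet → Fin 3) × Fin n) : Prop :=
  (∀ e : G.edgeSet, phi3 (s.1 e) (t.1 e)) ∧ s.2 ≠ t.2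

/-- A set of tuples satisfies `X → A` if no ordered pair of its tuples (possibly
equal) is a counterexample to `X → A`. -/
def SatisfiesT {n : ℕ} (G : SimpleGraph (Fin n))
    (S : Set ((G.edgeSet → Fin 3) × Fin n)) : Prop :=
  ∀ s ∈ S, ∀ t ∈ S, ¬ CounterexampleT G s t

theorem phi3_vertexTuple_of_not_mem_and_mem {n : ℕ} (G : SimpleGraph (Fin n)) {i j : Fin n}
    {e : G.edgeSet} (h : ¬ (i ∈ (e : Sym2 (Fin n)) ∧ j ∈ (e : Sym2 (Fin n)))) :
    phi3 (vertexTuple G i e) (vertexTuple G j e) := by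
  unfold phi3 vertexTuple
  split_ifs <;> simp_all

theorem not_phi3_vertexTuple_of_adj {n : ℕ} (G : SimpleGraph (Fin n)) {i j : Fin n}
    (h : G.Adj i j) :
    ¬ phi3 (vertexTuple G i ⟨s(i, j), h⟩) (vertexTuple G j ⟨s(i, j), h⟩) := by
  have hne := h.ne
  rcases lt_or_gt_of_ne hne with hlt | hlt
  · simp [phi3, vertexTuple, inf_eq_left.2 hlt.le, hne.symm]
  · simp [phi3, vertexTuple, inf_eq_right.2 hlt.le, hne]

theorem counterexampleT_iff {n : ℕ} (G : SimpleGraph (Fin n)) (i j : Fin n) :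
    CounterexampleT G (T G i) (T G j) ↔ i ≠ j ∧ ¬ G.Adj i j := by
  refine ⟨fun ⟨hphi, hne⟩ ↦ ⟨hne, fun hadj ↦ not_phi3_vertexTuple_of_adj G hadj (hphi _)⟩,
    fun ⟨hne, hadj⟩ ↦ ⟨fun e ↦ phi3_vertexTuple_of_not_mem_and_mem G fun hmem ↦ hadj ?_, hne⟩⟩
  rw [← SimpleGraph.mem_edgeSet, ← (Sym2.mem_and_mem_iff hne).1 hmem]
  exact e.2

theorem isClique_iff_satisfiesT {n : ℕ} (G : SimpleGraph (Fin n)) (K : Set (Fin n)) :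
    G.IsClique K ↔ SatisfiesT G (T G '' K) := by
  simp only [SatisfiesT, Set.forall_mem_image, counterexampleT_iff, not_and, not_not]
  rfl

theorem T_injective {n : ℕ} (G : SimpleGraph (Fin n)) : Function.Injective (T G) :=
  fun _ _ h ↦ congrArg Prod.snd h

theorem stmt_8 {n : ℕ} (G : SimpleGraph (Fin n)) :
    (∀ K : Set (Fin n), G.IsClique K ↔ SatisfiesT G (T G '' K)) ∧
    sSup {k : ℕ | ∃ K : Set (Fin n), G.IsClique K ∧ K.ncard = k} =
      sSup {k : ℕ | ∃ S ⊆ Set.range (T G), SatisfiesT G S ∧ S.ncard = k} := by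
  refine ⟨isClique_iff_satisfiesT G, ?_⟩
  congr 1
  ext k
  simp only [Set.mem_ofPred_eq, Set.exists_subset_range_and_iff, ← isClique_iff_satisfiesT,
    Set.ncard_image_of_injective _ (T_injective G)]
end

section
/- Let G be a loopless simple graph on Fin n in which every vertex lies on at least one edge, and let G₂ be its 2-subdivision, with vertex set W consisting of the original vertices i together with pairs (e,i) for each edge e of G and each endpoint i of e. Define the tuple map τ : W → (Fin n × Fin n) × Fin n by τ(i) = ((i,i), i) for original vertices i, and τ((e,i)) = ((min(i,j), max(i,j)), j) where j is the other endpoint of e = {i,j}. Define ψ on Fin n × Fin n by ψ p q ↔ (p = q ∨ (p.1 = p.2 ∧ (p.1 = q.1 ∨ p.1 = q.2))), and call an ordered pair of tuples (s,t) a counterexample if ψ (s.1) (t.1) holds and s.2 ≠ t.2. Then for all distinct x, y ∈ W: x and y are adjacent in G₂ if and only if (τ x, τ y) or (τ y, τ x) is a counterexample. -/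
/-- Vertex set of the 2-subdivision of `G`: original vertices together with pairs
`(e, i)` where `e` is an edge of `G` and `i` an endpoint of `e`. -/
def W {n : ℕ} (G : SimpleGraph (Fin n)) : Type :=
  Fin n ⊕ (Σ e : G.edgeSet, {i : Fin n // i ∈ (e : Sym2 (Fin n))})

/-- Base relation for the 2-subdivision: an original vertex `i` is related to `(e, i)`
whenever `i` is an endpoint of `e`; and `(e, i)` is related to `(e', i')` whenever
`e = e'` and `i ≠ i'`; original vertices are pairwise unrelated. -/
def subdivRel {n : ℕ} (G : SimpleGraph (Fin n)) : W G → W G → Prop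
  | Sum.inl _, Sum.inl _ => False
  | Sum.inl i, Sum.inr p => i = p.2.1
  | Sum.inr p, Sum.inl i => i = p.2.1
  | Sum.inr p, Sum.inr q => p.1 = q.1 ∧ p.2.1 ≠ q.2.1

/-- The 2-subdivision `G₂` of `G`. -/
def subdivision {n : ℕ} (G : SimpleGraph (Fin n)) : SimpleGraph (W G) :=
  SimpleGraph.fromRel (subdivRel G)

/-- The predicate `ψ` on `Fin n × Fin n`. -/
def psi {n : ℕ} (p q : Fin n × Fin n) : Prop :=
  p = q ∨ (p.1 = p.2 ∧ (p.1 = q.1 ∨ p.1 = q.2))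

/-- The tuple map `τ`: an original vertex `i` is sent to `((i, i), i)`, and a
subdivision vertex `(e, i)` with `e = {i, j}` is sent to `((min i j, max i j), j)`,
where `j` is the other endpoint of `e`. -/
def tau {n : ℕ} (G : SimpleGraph (Fin n)) : W G → (Fin n × Fin n) × Fin n
  | Sum.inl i => ((i, i), i)
  | Sum.inr p =>
      ((min p.2.1 (Sym2.Mem.other' p.2.2), max p.2.1 (Sym2.Mem.other' p.2.2)),
        Sym2.Mem.other' p.2.2)

/-- `(s, t)` is a counterexample to `B → A`: `ψ` holds on the `B`-values but the
`A`-values differ. -/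
def CounterexampleBA {n : ℕ} (s t : (Fin n × Fin n) × Fin n) : Prop :=
  psi s.1 t.1 ∧ s.2 ≠ t.2

/-- The edge underlying a subdivision vertex joins its endpoint to the other endpoint. -/
theorem mk_other'_eq {n : ℕ} {G : SimpleGraph (Fin n)}
    (p : Σ e : G.edgeSet, {i : Fin n // i ∈ (e : Sym2 (Fin n))}) :
    s(p.2.1, Sym2.Mem.other' p.2.2) = (p.1 : Sym2 (Fin n)) :=
  Sym2.other_spec' p.2.2

theorem ne_other' {n : ℕ} {G : SimpleGraph (Fin n)}
    (p : Σ e : G.edgeSet, {i : Fin n // i ∈ (e : Sym2 (Fin n))}) :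
    p.2.1 ≠ Sym2.Mem.other' p.2.2 := by
  have h : s(p.2.1, Sym2.Mem.other' p.2.2) ∈ G.edgeSet := by
    rw [mk_other'_eq]; exact p.1.2
  exact G.ne_of_adj h

/-- An original vertex is related to `(e, i)` exactly when their tuples, in one of the two orders,
form a counterexample. -/
theorem counterexampleBA_original_iff {n : ℕ} (G : SimpleGraph (Fin n)) (i : Fin n)
    (p : Σ e : G.edgeSet, {i : Fin n // i ∈ (e : Sym2 (Fin n))}) :
    (CounterexampleBA (tau G (Sum.inl i)) (tau G (Sum.inr p)) ∨
      CounterexampleBA (tau G (Sum.inr p)) (tau G (Sum.inl i))) ↔ i = p.2.1 := by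
  have hp := ne_other' p
  simp only [CounterexampleBA, tau, psi, Prod.mk.injEq]
  generalize Sym2.Mem.other' p.2.2 = k at *
  generalize p.2.1 = j at *
  grind

theorem counterexampleBA_subdivision_iff {n : ℕ} (G : SimpleGraph (Fin n))
    (p q : Σ e : G.edgeSet, {i : Fin n // i ∈ (e : Sym2 (Fin n))}) :
    CounterexampleBA (tau G (Sum.inr p)) (tau G (Sum.inr q)) ↔ p.1 = q.1 ∧ p.2.1 ≠ q.2.1 := by
  have hp := ne_other' p
  have hq := ne_other' q
  have hpq : p.1 = q.1 ↔ s(p.2.1, Sym2.Mem.other' p.2.2) = s(q.2.1, Sym2.Mem.other' q.2.2) := by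
    rw [mk_other'_eq p, mk_other'_eq q, Subtype.ext_iff]
  refine Iff.trans ?_ (and_congr_left' (hpq.trans Sym2.eq_iff).symm)
  clear hpq
  simp only [CounterexampleBA, tau, psi, Prod.mk.injEq]
  generalize Sym2.Mem.other' p.2.2 = k at *
  generalize p.2.1 = j at *
  generalize Sym2.Mem.other' q.2.2 = k' at *
  generalize q.2.1 = j' at *
  grind

theorem stmt_10 {n : ℕ} (G : SimpleGraph (Fin n))
    (hcov : ∀ i : Fin n, ∃ j : Fin n, G.Adj i j)
    (x y : W G) (hxy : x ≠ y) :
    (subdivision G).Adj x y ↔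
      (CounterexampleBA (tau G x) (tau G y) ∨ CounterexampleBA (tau G y) (tau G x)) := by
  rw [subdivision, SimpleGraph.fromRel_adj, and_iff_right hxy]
  rcases x with i | p <;> rcases y with j | q
  · have hij : i ≠ j := fun h => hxy (congrArg Sum.inl h)
    simp [subdivRel, CounterexampleBA, tau, psi, hij, hij.symm]
  · exact (or_self_iff).trans (counterexampleBA_original_iff G i q).symm
  · exact (or_self_iff).trans ((counterexampleBA_original_iff G j p).symm.trans or_comm)
  · exact or_congr (counterexampleBA_subdivision_iff G p q).symm
      (counterexampleBA_subdivision_iff G q p).symm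
end

section
/- Let G be a loopless simple graph on Fin n in which every vertex lies on at least one edge, let G₂ be its 2-subdivision with vertex set W, and let τ : W → (Fin n × Fin n) × Fin n be the tuple map defined by τ(i) = ((i,i), i) and τ((e,i)) = ((min(i,j), max(i,j)), j) where j is the other endpoint of e = {i,j}. Then for every k, G₂ has an independent set of size k if and only if there is a subset S ⊆ W of size k such that τ(S) satisfies the functional dependency B → A; in particular, the independence number of G₂ equals the maximum cardinality of a subset S ⊆ W with τ(S) satisfying B → A. -/
/-- A set of tuples satisfies `B → A` if no ordered pair of its tuples (possibly
equal) is a counterexample to `B → A`. -/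
def SatisfiesBA {n : ℕ} (S : Set ((Fin n × Fin n) × Fin n)) : Prop :=
  ∀ s ∈ S, ∀ t ∈ S, ¬ CounterexampleBA s t

theorem min_max_eq_iff {α : Type*} [LinearOrder α] {a b c d : α} :
    (min a b, max a b) = (min c d, max c d) ↔ s(a, b) = s(c, d) := by
  rw [Prod.mk.injEq, Sym2.eq_iff]
  constructor
  · rintro ⟨h₁, h₂⟩
    grind
  · rintro (⟨rfl, rfl⟩ | ⟨rfl, rfl⟩)
    · exact ⟨rfl, rfl⟩
    · exact ⟨min_comm _ _, max_comm _ _⟩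

theorem subdivRel_irrefl {n : ℕ} (G : SimpleGraph (Fin n)) : ∀ x : W G, ¬ subdivRel G x x
  | Sum.inl _ => id
  | Sum.inr _ => fun h => h.2 rfl

theorem subdivision_adj_iff_subdivRel {n : ℕ} (G : SimpleGraph (Fin n)) (x y : W G) :
    (subdivision G).Adj x y ↔ subdivRel G x y ∨ subdivRel G y x := by
  rw [subdivision, SimpleGraph.fromRel_adj, and_iff_right_iff_imp]
  rintro h rfl
  exact subdivRel_irrefl G x (or_self_iff.1 h)

theorem subdivision_adj_iff {n : ℕ} (G : SimpleGraph (Fin n)) (x y : W G) :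
    (subdivision G).Adj x y ↔
      CounterexampleBA (tau G x) (tau G y) ∨ CounterexampleBA (tau G y) (tau G x) := by
  have edge (p : Σ e : G.edgeSet, {i : Fin n // i ∈ (e : Sym2 (Fin n))}) :
      s(p.2.1, Sym2.Mem.other' p.2.2) = p.1.1 ∧ p.2.1 ≠ Sym2.Mem.other' p.2.2 := by
    have h : s(p.2.1, Sym2.Mem.other' p.2.2) = p.1.1 := Sym2.other_spec' p.2.2
    have h_adj : s(p.2.1, Sym2.Mem.other' p.2.2) ∈ G.edgeSet := by
      rw [h]
      exact p.1.2
    exact ⟨h, G.ne_of_adj h_adj⟩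
  have vertex_edge (i : Fin n) (p : Σ e : G.edgeSet, {i : Fin n // i ∈ (e : Sym2 (Fin n))}) :
      i = p.2.1 ↔ CounterexampleBA (tau G (Sum.inl i)) (tau G (Sum.inr p)) ∨
        CounterexampleBA (tau G (Sum.inr p)) (tau G (Sum.inl i)) := by
    have h := (edge p).2
    simp only [CounterexampleBA, psi, tau, Prod.mk.injEq]
    grind
  rw [subdivision_adj_iff_subdivRel]
  rcases x with i | p <;> rcases y with j | q
  · simp only [subdivRel, CounterexampleBA, psi, tau,
      Prod.mk.injEq]
    grind
  · rw [← vertex_edge]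
    simp [subdivRel]
  · rw [or_comm (a := CounterexampleBA _ _), ← vertex_edge]
    simp [subdivRel]
  · obtain ⟨hp, hp_ne⟩ := edge p
    obtain ⟨hq, hq_ne⟩ := edge q
    have h_eq : p.1 = q.1 ↔ s(p.2.1, Sym2.Mem.other' p.2.2) = s(q.2.1, Sym2.Mem.other' q.2.2) := by
      rw [hp, hq, Subtype.ext_iff]
    simp only [subdivRel, CounterexampleBA, psi, tau, min_max_eq_iff, eq_comm (a := q.1), h_eq,
      Sym2.eq_iff, inf_eq_sup, hp_ne, hq_ne, false_and, or_false]
    grind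

theorem pairwise_not_adj_iff_satisfiesBA {n : ℕ} (G : SimpleGraph (Fin n)) (S : Set (W G)) :
    (S.Pairwise fun x y => ¬ (subdivision G).Adj x y) ↔ SatisfiesBA (tau G '' S) := by
  simp only [SatisfiesBA, Set.forall_mem_image]
  constructor
  · intro h x hx y hy hxy
    have h_adj := (subdivision_adj_iff G x y).2 (Or.inl hxy)
    exact h hx hy h_adj.ne h_adj
  · intro h x hx y hy _ h_adj
    exact ((subdivision_adj_iff G x y).1 h_adj).elim (h hx hy) (h hy hx)

theorem stmt_11 {n : ℕ} (G : SimpleGraph (Fin n))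
    (hcov : ∀ i : Fin n, ∃ j : Fin n, G.Adj i j) :
    (∀ k : ℕ,
      (∃ I : Set (W G), (I.Pairwise fun x y => ¬ (subdivision G).Adj x y) ∧ I.ncard = k) ↔
      (∃ S : Set (W G), SatisfiesBA (tau G '' S) ∧ S.ncard = k)) ∧
    sSup {k : ℕ | ∃ I : Set (W G),
        (I.Pairwise fun x y => ¬ (subdivision G).Adj x y) ∧ I.ncard = k} =
      sSup {k : ℕ | ∃ S : Set (W G), SatisfiesBA (tau G '' S) ∧ S.ncard = k} := by
  simp only [pairwise_not_adj_iff_satisfiesBA, implies_true, and_self]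
end

section
/- Suppose φ_B is transitive for every attribute B ∈ X, and the domain of attribute A carries a linear order with φ_A x y given by x ≤ y. Define the relation ⊑ on tuples by t ⊑ t' iff t = t' or (t,t') is a counterexample to X → A. Then ⊑ is reflexive, antisymmetric, and transitive; that is, ⊑ is a partial order on tuples. -/
/-- The relation `⊑` on tuples: `t ⊑ t'` iff `t = t'` or `(t, t')` is a
counterexample to `X → A`. -/
def sqle {ι : Type*} {D : ι → Type*} (φ : ∀ i, D i → D i → Prop)
    (X : Set ι) (A : ι) (t t' : ∀ i, D i) : Prop :=
  t = t' ∨ Counterexample φ X A t t'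

theorem stmt_12 {ι : Type*} {D : ι → Type*} (φ : ∀ i, D i → D i → Prop)
    (X : Set ι) (A : ι) [LinearOrder (D A)]
    (hA : ∀ x y : D A, φ A x y ↔ x ≤ y)
    (hX : ∀ B ∈ X, ∀ x y z : D B, φ B x y → φ B y z → φ B x z) :
    (∀ t : ∀ i, D i, sqle φ X A t t) ∧
    (∀ t t' : ∀ i, D i, sqle φ X A t t' → sqle φ X A t' t → t = t') ∧
    (∀ t t' t'' : ∀ i, D i, sqle φ X A t t' → sqle φ X A t' t'' → sqle φ X A t t'') := by
  refine ⟨fun t => Or.inl rfl, ?_⟩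
  simp only [sqle, Counterexample, hA, not_le]
  constructor
  · rintro t t' (rfl | ⟨-, h⟩) (h' | ⟨-, h'⟩)
    · rfl
    · rfl
    · exact h'.symm
    · exact absurd h' h.asymm
  · rintro t t' t'' (rfl | ⟨h, hlt⟩) (rfl | ⟨h', hlt'⟩)
    · exact Or.inl rfl
    · exact Or.inr ⟨h', hlt'⟩
    · exact Or.inr ⟨h, hlt⟩
    · exact Or.inr ⟨fun B hB => hX B hB _ _ _ (h B hB) (h' B hB), hlt'.trans hlt⟩
end

section
/- Suppose φ_B is transitive for every attribute B ∈ X, and the domain of attribute A carries a linear order with φ_A x y given by x ≤ y. Let r be a finite relation of tuples. Then the conflict graph of X → A on r is a comparability graph: there exists a partial order ⪯ on r such that two distinct tuples t, t' ∈ r are adjacent in the conflict graph if and only if t ⪯ t' or t' ⪯ t. -/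
theorem Counterexample.trans {ι : Type*} {D : ι → Type*} {φ : ∀ i, D i → D i → Prop}
    {X : Set ι} {A : ι} [LinearOrder (D A)] (hA : ∀ x y : D A, φ A x y ↔ x ≤ y)
    (hX : ∀ B ∈ X, ∀ x y z : D B, φ B x y → φ B y z → φ B x z)
    {s t u : ∀ i, D i} (hst : Counterexample φ X A s t) (htu : Counterexample φ X A t u) :
    Counterexample φ X A s u := by
  obtain ⟨hst, hst'⟩ := hst
  obtain ⟨htu, htu'⟩ := htu
  rw [hA, not_le] at hst' htu'
  refine ⟨fun B hB => hX B hB _ _ _ (hst B hB) (htu B hB), ?_⟩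
  rw [hA, not_le]
  exact htu'.trans hst'

theorem Counterexample.asymm {ι : Type*} {D : ι → Type*} {φ : ∀ i, D i → D i → Prop}
    {X : Set ι} {A : ι} [LinearOrder (D A)] (hA : ∀ x y : D A, φ A x y ↔ x ≤ y)
    {s t : ∀ i, D i} (hst : Counterexample φ X A s t) : ¬ Counterexample φ X A t s := by
  intro hts
  have h := hst.2
  have h' := hts.2
  rw [hA, not_le] at h h'
  exact h.asymm h'

theorem stmt_14 {ι : Type*} {D : ι → Type*} (φ : ∀ i, D i → D i → Prop)
    (X : Set ι) (A : ι) [LinearOrder (D A)]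
    (hA : ∀ x y : D A, φ A x y ↔ x ≤ y)
    (hX : ∀ B ∈ X, ∀ x y z : D B, φ B x y → φ B y z → φ B x z)
    (r : Set (∀ i, D i)) (hr : r.Finite) :
    ∃ le : r → r → Prop,
      (∀ t, le t t) ∧
      (∀ t t', le t t' → le t' t → t = t') ∧
      (∀ t t' t'', le t t' → le t' t'' → le t t'') ∧
      (∀ t t' : r, t ≠ t' → ((conflictGraph φ X A r).Adj t t' ↔ le t t' ∨ le t' t)) := by
  refine ⟨fun t t' => t = t' ∨ Counterexample φ X A (t : ∀ i, D i) t', fun t => Or.inl rfl,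
    ?_, ?_, ?_⟩
  · rintro t t' (h | h) (h' | h')
    · exact h
    · exact h
    · exact h'.symm
    · exact absurd h' (h.asymm hA)
  · rintro t t' t'' (rfl | h) (rfl | h')
    · exact Or.inl rfl
    · exact Or.inr h'
    · exact Or.inr h
    · exact Or.inr (h.trans hA hX h')
  · intro t t' hne
    simp [conflictGraph, SimpleGraph.fromRel_adj, hne, hne.symm]
end
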